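/- For every constant C > 0 there is a constant B > 0 such that for all integers n with n > C², ∑_{π ∈ S_n} (C/n^{3/2})^{t(π)} ≤ B·√n·e^{(C/2)√n}. -/

import Mathlib

noncomputable section

/-- `t(π) = s(π) − c(π)`: the minimal number of transpositions whose product is `π`,
where `s(π)` is the number of points moved by `π` and `c(π)` is the number of
nontrivial cycles of `π`. -/
def tPerm {n : ℕ} (π : Equiv.Perm (Fin n)) : ℕ :=
  π.support.card - π.cycleType.card

open Equiv Equiv.Perm

lemma card_cycleType_le_card_support {n : ℕ} (π : Perm (Fin n)) :
    π.cycleType.card ≤ π.support.card := by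
  rw [← sum_cycleType]
  simpa using Multiset.card_nsmul_le_sum (s := π.cycleType) (a := 1)
    fun x hx => (one_lt_of_mem_cycleType hx).le

lemma tPerm_one {n : ℕ} : tPerm (1 : Perm (Fin n)) = 0 := by
  simp [tPerm]

lemma Equiv.Perm.Disjoint.tPerm_mul {n : ℕ} {σ τ : Perm (Fin n)} (h : Perm.Disjoint σ τ) :
    tPerm (σ * τ) = tPerm σ + tPerm τ := by
  have h1 := card_cycleType_le_card_support σ
  have h2 := card_cycleType_le_card_support τ
  simp only [tPerm, h.cycleType_mul, h.card_support_mul, Multiset.card_add]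
  omega

lemma Equiv.Perm.IsCycle.tPerm_eq {n : ℕ} {σ : Perm (Fin n)} (h : σ.IsCycle) :
    tPerm σ = σ.support.card - 1 := by
  simp [tPerm, h.cycleType]

lemma Equiv.Perm.IsCycle.tPerm_swap_mul {n : ℕ} {c : Perm (Fin n)} (hc : c.IsCycle) {a : Fin n}
    (ha : c a ≠ a) : tPerm (swap a (c a) * c) + 1 = tPerm c := by
  by_cases h : c (c a) = a
  · have hs := hc.eq_swap_of_apply_apply_eq_self ha h
    have h1 : swap a (c a) * c = 1 := by
      nth_rw 2 [hs]
      exact swap_mul_self _ _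
    rw [h1, tPerm_one, hc.tPerm_eq, hs, card_support_swap (Ne.symm ha)]
  · have hmem : a ∈ c.support := mem_support.mpr ha
    rw [(hc.swap_mul ha h).tPerm_eq, hc.tPerm_eq, support_swap_mul_eq c a h,
      Finset.sdiff_singleton_eq_erase, Finset.card_erase_of_mem hmem]
    have := hc.two_le_card_support
    omega

/-- Cutting a moved point `a` out of its cycle lowers `tPerm` by one. -/
lemma tPerm_swap_mul {n : ℕ} {π : Perm (Fin n)} {a : Fin n} (ha : π a ≠ a) :
    tPerm (swap a (π a) * π) + 1 = tPerm π := by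
  set c := π.cycleOf a with hc
  have hcyc : c.IsCycle := isCycle_cycleOf π ha
  have hca : c a = π a := cycleOf_apply_self π a
  have hd : Perm.Disjoint (π * c⁻¹) c := disjoint_mul_inv_of_mem_cycleFactorsFinset
    (cycleOf_mem_cycleFactorsFinset_iff.mpr (mem_support.mpr ha))
  have hπ : π = c * (π * c⁻¹) := by rw [← hd.commute.eq]; group
  have hd' : Perm.Disjoint (swap a (π a) * c) (π * c⁻¹) := by
    refine Perm.Disjoint.mul_left ?_ hd.symm
    rw [disjoint_iff_disjoint_support, support_swap (Ne.symm ha)]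
    refine Finset.disjoint_of_subset_left ?_ (disjoint_iff_disjoint_support.mp hd.symm)
    have hmem : a ∈ c.support := mem_support.mpr (hca ▸ ha)
    simp only [Finset.insert_subset_iff, Finset.singleton_subset_iff]
    exact ⟨hmem, hca ▸ apply_mem_support.mpr hmem⟩
  have h1 : swap a (π a) * π = swap a (π a) * c * (π * c⁻¹) := by
    rw [mul_assoc, ← hπ]
  have h2 : tPerm π = tPerm c + tPerm (π * c⁻¹) := by
    rw [← hd.symm.tPerm_mul, ← hπ]
  have h3 := hcyc.tPerm_swap_mul (hca ▸ ha)
  rw [hca] at h3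
  rw [h1, hd'.tPerm_mul, h2]
  omega

lemma tPerm_decomposeFin_symm_zero {n : ℕ} (e : Perm (Fin n)) :
    tPerm (decomposeFin.symm (0, e)) = tPerm e := by
  have h : decomposeFin.symm (0, e) = e.extendDomain (finSuccAboveEquiv 0) := by
    ext x
    refine Fin.cases ?_ (fun i => ?_) x
    · rw [decomposeFin_symm_apply_zero, extendDomain_apply_not_subtype _ _ (by simp)]
    · have := extendDomain_apply_image e (finSuccAboveEquiv (0 : Fin (n + 1))) i
      simp only [finSuccAboveEquiv_apply, Fin.zero_succAbove] at this
      simp [this]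
  rw [h, tPerm, tPerm, cycleType_extendDomain, card_support_extend_domain]

lemma tPerm_decomposeFin_symm_of_ne_zero {n : ℕ} {p : Fin (n + 1)} (hp : p ≠ 0)
    (e : Perm (Fin n)) : tPerm (decomposeFin.symm (p, e)) = tPerm e + 1 := by
  have h0 : decomposeFin.symm (p, e) 0 = p := decomposeFin_symm_apply_zero p e
  have h : swap 0 p * decomposeFin.symm (p, e) = decomposeFin.symm (0, e) := by
    ext x
    refine Fin.cases ?_ (fun i => ?_) x <;> simp
  have := tPerm_swap_mul (π := decomposeFin.symm (p, e)) (a := 0) (by rwa [h0])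
  rw [h0, h, tPerm_decomposeFin_symm_zero] at this
  exact this.symm

lemma sum_pow_tPerm_succ (n : ℕ) (x : ℝ) :
    ∑ π : Perm (Fin (n + 1)), x ^ tPerm π = (1 + n * x) * ∑ π : Perm (Fin n), x ^ tPerm π := by
  rw [← decomposeFin.symm.sum_comp, Fintype.sum_prod_type, Fin.sum_univ_succ]
  simp only [tPerm_decomposeFin_symm_zero,
    tPerm_decomposeFin_symm_of_ne_zero (Fin.succ_ne_zero _), pow_succ, ← Finset.sum_mul]
  simp only [Finset.sum_const, Finset.card_univ, Fintype.card_fin, nsmul_eq_mul]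
  ring

lemma sum_pow_tPerm_le_exp (n : ℕ) {x : ℝ} (hx : 0 ≤ x) :
    ∑ π : Perm (Fin n), x ^ tPerm π ≤ Real.exp (x * n ^ 2 / 2) := by
  induction n with
  | zero => simp [tPerm]
  | succ n ih =>
    rw [sum_pow_tPerm_succ]
    calc (1 + n * x) * ∑ π : Perm (Fin n), x ^ tPerm π
        ≤ Real.exp (n * x) * Real.exp (x * n ^ 2 / 2) := by
          gcongr
          rw [add_comm]
          exact Real.add_one_le_exp _
      _ ≤ Real.exp (x * (n + 1 : ℕ) ^ 2 / 2) := by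
          rw [← Real.exp_add, Real.exp_le_exp]
          push_cast
          linarith

/-- For every constant `C > 0` there is a constant `B > 0` such that for all integers
`n > C²`, `∑_{π ∈ S_n} (C/n^{3/2})^{t(π)} ≤ B·√n·e^{(C/2)√n}`. -/
theorem sum_pow_t_three_halves_le (C : ℝ) (hC : 0 < C) :
    ∃ B : ℝ, 0 < B ∧ ∀ n : ℕ, C ^ 2 < (n : ℝ) →
      ∑ π : Equiv.Perm (Fin n), (C / (n : ℝ) ^ ((3 : ℝ) / 2)) ^ tPerm π ≤
        B * Real.sqrt n * Real.exp ((C / 2) * Real.sqrt n) := by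
  refine ⟨1, one_pos, fun n hn => ?_⟩
  have hn0 : (0 : ℝ) < n := (by positivity : 0 < C ^ 2).trans hn
  have hn1 : (1 : ℝ) ≤ n := by exact_mod_cast Nat.cast_pos.mp hn0
  have hpow : (n : ℝ) ^ 2 = (n : ℝ) ^ ((3 : ℝ) / 2) * Real.sqrt n := by
    rw [Real.sqrt_eq_rpow, ← Real.rpow_add hn0, ← Real.rpow_natCast]
    norm_num
  have hexp : C / (n : ℝ) ^ ((3 : ℝ) / 2) * n ^ 2 / 2 = C / 2 * Real.sqrt n := by
    have : (0 : ℝ) < (n : ℝ) ^ ((3 : ℝ) / 2) := Real.rpow_pos_of_pos hn0 _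
    rw [hpow]
    field_simp
  refine (sum_pow_tPerm_le_exp n (by positivity)).trans ?_
  rw [hexp, one_mul]
  exact le_mul_of_one_le_left (Real.exp_pos _).le (Real.one_le_sqrt.mpr hn1)
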